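/- Let I be a nonempty set. Then M_I is Morita equivalent to ℂ: the bimodules P = ℓ¹(I) (as a left-ℂ right-M_I Banach bimodule) and Q = ℓ¹(I) (as a left-M_I right-ℂ Banach bimodule) are two-sided induced, P ⊗̂_{M_I} Q is topologically isomorphic to ℂ, and Q ⊗̂_ℂ P is topologically isomorphic to M_I as an M_I-bimodule. -/

import Mathlib

open scoped TensorProduct BigOperators ENNReal
open Filter

noncomputable section

/-- `ℓ¹(X)`: the Banach space of absolutely summable complex functions on `X`. -/
abbrev L1 (X : Type) : Type := lp (fun _ : X => ℂ) 1

open Classical in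
/-- The point mass `δ_x` in `ℓ¹(X)`. -/
noncomputable def delta {X : Type} (x : X) : L1 X := lp.single 1 x (1 : ℂ)

/-- The projective tensor norm of an element of the algebraic tensor product
`E ⊗[ℂ] F`: the infimum of `∑ ‖xᵢ‖ ‖yᵢ‖` over all finite representations
`z = ∑ xᵢ ⊗ yᵢ`. -/
def projNorm {E F : Type} [SeminormedAddCommGroup E] [NormedSpace ℂ E]
    [SeminormedAddCommGroup F] [NormedSpace ℂ F] (z : E ⊗[ℂ] F) : ℝ :=
  sInf {r : ℝ | ∃ (n : ℕ) (x : Fin n → E) (y : Fin n → F),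
    z = ∑ i, x i ⊗ₜ[ℂ] y i ∧ r = ∑ i, ‖x i‖ * ‖y i‖}

/-- `(T, φ)` is a realization of the completed projective tensor product `E ⊗̂ F`:
`T` is a Banach space, the canonical map from the algebraic tensor product is an
isometry with respect to the projective tensor norm, and it has dense range. -/
structure IsProjTensor (E F T : Type) [SeminormedAddCommGroup E] [NormedSpace ℂ E]
    [SeminormedAddCommGroup F] [NormedSpace ℂ F]
    [SeminormedAddCommGroup T] [NormedSpace ℂ T]
    (φ : E →ₗ[ℂ] F →ₗ[ℂ] T) : Prop where
  complete : CompleteSpace T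
  isometry : ∀ z : E ⊗[ℂ] F, ‖TensorProduct.lift φ z‖ = projNorm z
  dense : DenseRange ⇑(TensorProduct.lift φ)

/-- The closed linear span of the `A`-balancing relations
`{x·a ⊗ y - x ⊗ a·y}` inside a realization `T` of `E ⊗̂ F`; the quotient
`T ⧸ balancer φ r l` is the `A`-module tensor product `E ⊗̂_A F`. -/
def balancer {A E F T : Type} [SeminormedAddCommGroup E] [NormedSpace ℂ E]
    [SeminormedAddCommGroup F] [NormedSpace ℂ F]
    [SeminormedAddCommGroup T] [NormedSpace ℂ T]
    (φ : E →ₗ[ℂ] F →ₗ[ℂ] T) (r : E → A → E) (l : A → F → F) : Submodule ℂ T :=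
  (Submodule.span ℂ {z : T | ∃ (x : E) (a : A) (y : F), z = φ (r x a) y - φ x (l a y)}).topologicalClosure

/-- A left Banach `A`-module `(E, l)` is `A`-induced: for every realization `T` of
`A ⊗̂ E`, the canonical map `A ⊗̂_A E → E`, `a ⊗ x ↦ a·x`, is a topological
isomorphism. -/
def LeftInduced {A E : Type} [SeminormedAddCommGroup A] [NormedSpace ℂ A]
    [SeminormedAddCommGroup E] [NormedSpace ℂ E]
    (mulA : A →L[ℂ] A →L[ℂ] A) (l : A →L[ℂ] E →L[ℂ] E) : Prop :=
  ∀ (T : Type) [SeminormedAddCommGroup T] [NormedSpace ℂ T]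
    (φ : A →ₗ[ℂ] E →ₗ[ℂ] T), IsProjTensor A E T φ →
    ∃ e : (T ⧸ balancer φ (fun a b => mulA a b) (fun a x => l a x)) ≃L[ℂ] E,
      ∀ (a : A) (x : E), e (Submodule.Quotient.mk (φ a x)) = l a x

/-- A right Banach `A`-module `(E, r)` is `A`-induced. -/
def RightInduced {A E : Type} [SeminormedAddCommGroup A] [NormedSpace ℂ A]
    [SeminormedAddCommGroup E] [NormedSpace ℂ E]
    (mulA : A →L[ℂ] A →L[ℂ] A) (r : E →L[ℂ] A →L[ℂ] E) : Prop :=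
  ∀ (T : Type) [SeminormedAddCommGroup T] [NormedSpace ℂ T]
    (φ : E →ₗ[ℂ] A →ₗ[ℂ] T), IsProjTensor E A T φ →
    ∃ e : (T ⧸ balancer φ (fun x a => r x a) (fun a b => mulA a b)) ≃L[ℂ] E,
      ∀ (x : E) (a : A), e (Submodule.Quotient.mk (φ x a)) = r x a

/-- A Banach algebra `(A, mul)` is self-induced: the multiplication map
`A ⊗̂_A A → A` is an isomorphism of `A`-bimodules. -/
def SelfInduced {A : Type} [SeminormedAddCommGroup A] [NormedSpace ℂ A]
    (mulA : A →L[ℂ] A →L[ℂ] A) : Prop :=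
  ∀ (T : Type) [SeminormedAddCommGroup T] [NormedSpace ℂ T]
    (φ : A →ₗ[ℂ] A →ₗ[ℂ] T), IsProjTensor A A T φ →
    ∃ e : (T ⧸ balancer φ (fun a b => mulA a b) (fun a b => mulA a b)) ≃L[ℂ] A,
      (∀ a b : A, e (Submodule.Quotient.mk (φ a b)) = mulA a b) ∧
      (∀ c a b : A, e (Submodule.Quotient.mk (φ (mulA c a) b))
          = mulA c (e (Submodule.Quotient.mk (φ a b)))) ∧
      (∀ a b c : A, e (Submodule.Quotient.mk (φ a (mulA b c)))
          = mulA (e (Submodule.Quotient.mk (φ a b))) c)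

/-- `(E, l, r)` is a Banach bimodule: left over `(A, mulL)`, right over `(B, mulR)`. -/
def IsBimoduleLaw {A B E : Type} [SeminormedAddCommGroup A] [NormedSpace ℂ A]
    [SeminormedAddCommGroup B] [NormedSpace ℂ B]
    [SeminormedAddCommGroup E] [NormedSpace ℂ E]
    (mulL : A →L[ℂ] A →L[ℂ] A) (mulR : B →L[ℂ] B →L[ℂ] B)
    (l : A →L[ℂ] E →L[ℂ] E) (r : E →L[ℂ] B →L[ℂ] E) : Prop :=
  (∀ (a a' : A) (x : E), l (mulL a a') x = l a (l a' x)) ∧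
  (∀ (x : E) (b b' : B), r (r x b) b' = r x (mulR b b')) ∧
  (∀ (a : A) (x : E) (b : B), r (l a x) b = l a (r x b))

/-- A witness for Morita equivalence of `(A, mulA)` and `(B, mulB)` in the sense of
Grønbæk's characterization: two-sided induced Banach bimodules `P ∈ B-mod-A` and
`Q ∈ A-mod-B` with `P ⊗̂_A Q ≅ B` and `Q ⊗̂_B P ≅ A` as bimodules. -/
structure MoritaWitness (A B : Type) [NormedAddCommGroup A] [NormedSpace ℂ A]
    [NormedAddCommGroup B] [NormedSpace ℂ B]
    (mulA : A →L[ℂ] A →L[ℂ] A) (mulB : B →L[ℂ] B →L[ℂ] B) : Type 1 where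
  P : Type
  Q : Type
  [iP1 : NormedAddCommGroup P] [iP2 : NormedSpace ℂ P] [iP3 : CompleteSpace P]
  [iQ1 : NormedAddCommGroup Q] [iQ2 : NormedSpace ℂ Q] [iQ3 : CompleteSpace Q]
  lP : B →L[ℂ] P →L[ℂ] P
  rP : P →L[ℂ] A →L[ℂ] P
  lQ : A →L[ℂ] Q →L[ℂ] Q
  rQ : Q →L[ℂ] B →L[ℂ] Q
  lawP : IsBimoduleLaw mulB mulA lP rP
  lawQ : IsBimoduleLaw mulA mulB lQ rQ
  indPl : LeftInduced mulB lP
  indPr : RightInduced mulA rP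
  indQl : LeftInduced mulA lQ
  indQr : RightInduced mulB rQ
  isoB : ∀ (T : Type) [SeminormedAddCommGroup T] [NormedSpace ℂ T]
    (φ : P →ₗ[ℂ] Q →ₗ[ℂ] T), IsProjTensor P Q T φ →
    ∃ e : (T ⧸ balancer φ (fun x a => rP x a) (fun a y => lQ a y)) ≃L[ℂ] B,
      (∀ (b : B) (p : P) (q : Q), e (Submodule.Quotient.mk (φ (lP b p) q))
          = mulB b (e (Submodule.Quotient.mk (φ p q)))) ∧
      (∀ (b : B) (p : P) (q : Q), e (Submodule.Quotient.mk (φ p (rQ q b)))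
          = mulB (e (Submodule.Quotient.mk (φ p q))) b)
  isoA : ∀ (T : Type) [SeminormedAddCommGroup T] [NormedSpace ℂ T]
    (φ : Q →ₗ[ℂ] P →ₗ[ℂ] T), IsProjTensor Q P T φ →
    ∃ e : (T ⧸ balancer φ (fun y b => rQ y b) (fun b x => lP b x)) ≃L[ℂ] A,
      (∀ (a : A) (q : Q) (p : P), e (Submodule.Quotient.mk (φ (lQ a q) p))
          = mulA a (e (Submodule.Quotient.mk (φ q p)))) ∧
      (∀ (a : A) (q : Q) (p : P), e (Submodule.Quotient.mk (φ q (rP p a)))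
          = mulA (e (Submodule.Quotient.mk (φ q p))) a)

/-- Morita equivalence of self-induced Banach algebras, via Grønbæk's
characterization. -/
def MoritaEquivalent {A B : Type} [NormedAddCommGroup A] [NormedSpace ℂ A]
    [NormedAddCommGroup B] [NormedSpace ℂ B]
    (mulA : A →L[ℂ] A →L[ℂ] A) (mulB : B →L[ℂ] B →L[ℂ] B) : Prop :=
  Nonempty (MoritaWitness A B mulA mulB)


/-! ### Basic facts on ℓ¹ -/

lemma L1.summable_norm {X : Type} (a : L1 X) : Summable fun x => ‖a x‖ := by
  have h := (lp.hasSum_norm (p := 1) (by simp) a).summable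
  simpa using h

lemma L1.norm_eq {X : Type} (a : L1 X) : ‖a‖ = ∑' x, ‖a x‖ := by
  have h := lp.norm_eq_tsum_rpow (p := 1) (by simp) a
  simpa using h

lemma norm_delta {X : Type} (x : X) : ‖(delta x : L1 X)‖ = 1 := by
  classical
  unfold delta
  rw [lp.norm_single (by simp)]
  simp

open Classical in
lemma delta_apply {X : Type} (x y : X) :
    (delta x : L1 X) y = if y = x then 1 else 0 := by
  change (Pi.single x (1 : ℂ) : X → ℂ) y = _
  rw [Pi.single_apply]

lemma L1.hasSum_delta {X : Type} (a : L1 X) : HasSum (fun x => a x • delta x) a := by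
  classical
  have h := lp.hasSum_single (p := 1) (by simp) a
  convert h using 2 with x
  ext y
  simp only [lp.coeFn_smul, Pi.smul_apply, delta_apply, lp.single_apply, Pi.single_apply]
  split_ifs with h
  · subst h; simp
  · simp

lemma L1.hom_eq {X V : Type} [SeminormedAddCommGroup V] [NormedSpace ℂ V] [T2Space V]
    (f g : L1 X →L[ℂ] V) (h : ∀ x, f (delta x) = g (delta x)) (a : L1 X) : f a = g a := by
  have h1 := (L1.hasSum_delta a).mapL f
  have h2 := (L1.hasSum_delta a).mapL g
  simp only [map_smul, h] at h1 h2
  exact h1.unique h2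

lemma L1.summable_smul {X V : Type} [SeminormedAddCommGroup V] [NormedSpace ℂ V] [CompleteSpace V]
    (t : X → V) (ht : ∀ x, ‖t x‖ ≤ 1) (a : L1 X) : Summable (fun x => ‖a x • t x‖) := by
  refine (L1.summable_norm a).of_nonneg_of_le (fun _ => norm_nonneg _) fun x => ?_
  rw [norm_smul]
  exact mul_le_of_le_one_right (norm_nonneg _) (ht x)

/-- The continuous linear map on `ℓ¹(X)` determined by a bounded family. -/
def L1.lift {X V : Type} [SeminormedAddCommGroup V] [NormedSpace ℂ V] [CompleteSpace V] [T2Space V]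
    (t : X → V) (ht : ∀ x, ‖t x‖ ≤ 1) : L1 X →L[ℂ] V :=
  LinearMap.mkContinuous
    { toFun := fun a => ∑' x, a x • t x
      map_add' := fun a b => by
        rw [← Summable.tsum_add (L1.summable_smul t ht a).of_norm (L1.summable_smul t ht b).of_norm]
        simp [add_smul]
      map_smul' := fun c a => by
        rw [RingHom.id_apply, ← Summable.tsum_const_smul c (L1.summable_smul t ht a).of_norm]
        simp [mul_smul] } 1 (fun a => by
      rw [one_mul, L1.norm_eq]
      refine (norm_tsum_le_tsum_norm (L1.summable_smul t ht a)).trans ?_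
      refine Summable.tsum_le_tsum (fun x => ?_) (L1.summable_smul t ht a) (L1.summable_norm a)
      rw [norm_smul]
      exact mul_le_of_le_one_right (norm_nonneg _) (ht x))

section lift
variable {X V : Type} [SeminormedAddCommGroup V] [NormedSpace ℂ V] [CompleteSpace V] [T2Space V]
    (t : X → V) (ht : ∀ x, ‖t x‖ ≤ 1)

lemma L1.lift_apply (a : L1 X) : L1.lift t ht a = ∑' x, a x • t x := rfl

lemma L1.hasSum_lift (a : L1 X) : HasSum (fun x => a x • t x) (L1.lift t ht a) :=
  (L1.summable_smul t ht a).of_norm.hasSum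

lemma L1.lift_delta (x : X) : L1.lift t ht (delta x) = t x := by
  classical
  rw [L1.lift_apply, tsum_eq_single x]
  · simp [delta_apply]
  · intro y hy; simp [delta_apply, hy]

lemma L1.norm_lift_le : ‖L1.lift t ht‖ ≤ 1 := LinearMap.mkContinuous_norm_le _ zero_le_one _

end lift

section bilift
variable {X Y V : Type} [NormedAddCommGroup V] [NormedSpace ℂ V] [CompleteSpace V]
    (m : X → Y → V) (hm : ∀ x y, ‖m x y‖ ≤ 1)

/-- The continuous bilinear map on `ℓ¹(X) × ℓ¹(Y)` determined by a bounded family. -/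
def L1.bilift : L1 X →L[ℂ] L1 Y →L[ℂ] V :=
  L1.lift (fun x => L1.lift (m x) (hm x)) (fun x => L1.norm_lift_le _ _)

lemma L1.bilift_delta (x : X) (y : Y) : L1.bilift m hm (delta x) (delta y) = m x y := by
  unfold L1.bilift
  rw [L1.lift_delta, L1.lift_delta]

lemma L1.bilift_eval (ψ : V →L[ℂ] ℂ) (a : L1 X) (b : L1 Y) :
    ψ (L1.bilift m hm a b) = ∑' x, a x * ∑' y, b y * ψ (m x y) := by
  have h1 : HasSum (fun x => a x * ψ (L1.lift (m x) (hm x) b)) (ψ (L1.bilift m hm a b)) := by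
    have := (L1.hasSum_lift (fun x => L1.lift (m x) (hm x)) (fun x => L1.norm_lift_le _ _) a).mapL
      (ψ.comp (ContinuousLinearMap.apply ℂ V b))
    simpa [L1.bilift] using this
  have h2 : ∀ x, ψ (L1.lift (m x) (hm x) b) = ∑' y, b y * ψ (m x y) := by
    intro x
    have := (L1.hasSum_lift (m x) (hm x) b).mapL ψ
    simpa using this.tsum_eq.symm
  rw [← h1.tsum_eq]
  simp only [h2]

end bilift

/-- Coordinate functional. -/
def L1.ev {X : Type} (x : X) : L1 X →L[ℂ] ℂ :=
  LinearMap.mkContinuous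
    { toFun := fun a => a x
      map_add' := fun a b => by simp
      map_smul' := fun c a => by simp } 1 (fun a => by
      rw [one_mul]; exact lp.norm_apply_le_norm (by simp) a x)

lemma L1.ev_apply {X : Type} (x : X) (a : L1 X) : L1.ev x a = a x := rfl

/-- Uniqueness for bilinear maps. -/
lemma L1.hom_eq₂ {X Y V : Type} [SeminormedAddCommGroup V] [NormedSpace ℂ V] [T2Space V]
    (f g : L1 X →L[ℂ] L1 Y →L[ℂ] V) (h : ∀ x y, f (delta x) (delta y) = g (delta x) (delta y))
    (a : L1 X) (b : L1 Y) : f a b = g a b := by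
  refine L1.hom_eq (f.flip b) (g.flip b) (fun x => ?_) a
  exact L1.hom_eq (f (delta x)) (g (delta x)) (h x) b

/-! ### Projective tensor products -/

lemma projNorm_le {E F : Type} [SeminormedAddCommGroup E] [NormedSpace ℂ E]
    [SeminormedAddCommGroup F] [NormedSpace ℂ F] (x : E) (y : F) :
    projNorm (x ⊗ₜ[ℂ] y) ≤ ‖x‖ * ‖y‖ := by
  refine csInf_le ⟨0, ?_⟩ ⟨1, fun _ => x, fun _ => y, by simp, by simp⟩
  rintro r ⟨n, x, y, -, rfl⟩
  positivity

section proj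
variable {E F T : Type} [SeminormedAddCommGroup E] [NormedSpace ℂ E]
    [SeminormedAddCommGroup F] [NormedSpace ℂ F] [SeminormedAddCommGroup T] [NormedSpace ℂ T]
    {φ : E →ₗ[ℂ] F →ₗ[ℂ] T}

lemma IsProjTensor.norm_le (h : IsProjTensor E F T φ) (x : E) (y : F) :
    ‖φ x y‖ ≤ ‖x‖ * ‖y‖ := by
  have := h.isometry (x ⊗ₜ[ℂ] y)
  rw [TensorProduct.lift.tmul] at this
  rw [this]; exact projNorm_le x y

/-- The canonical map as a continuous bilinear map. -/
def IsProjTensor.toL (h : IsProjTensor E F T φ) : E →L[ℂ] F →L[ℂ] T :=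
  LinearMap.mkContinuous₂ φ 1 (fun x y => by rw [one_mul]; exact h.norm_le x y)

lemma IsProjTensor.toL_apply (h : IsProjTensor E F T φ) (x : E) (y : F) :
    h.toL x y = φ x y := rfl

lemma IsProjTensor.lift_bound (h : IsProjTensor E F T φ) {G : Type} [NormedAddCommGroup G]
    [NormedSpace ℂ G] (β : E →ₗ[ℂ] F →ₗ[ℂ] G) (C : ℝ) (hC : 0 < C)
    (hβ : ∀ x y, ‖β x y‖ ≤ C * (‖x‖ * ‖y‖)) (z : E ⊗[ℂ] F) :
    ‖TensorProduct.lift β z‖ ≤ C * ‖TensorProduct.lift φ z‖ := by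
  rw [h.isometry, ← div_le_iff₀' hC]
  refine le_csInf ?_ ?_
  · obtain ⟨n, x, y, hz⟩ := TensorProduct.exists_sum_tmul_eq z
    exact ⟨_, n, x, y, hz, rfl⟩
  · rintro r ⟨n, x, y, rfl, rfl⟩
    rw [div_le_iff₀' hC, map_sum, Finset.mul_sum]
    refine (norm_sum_le _ _).trans (Finset.sum_le_sum fun i _ => ?_)
    rw [TensorProduct.lift.tmul]; exact hβ _ _

lemma IsProjTensor.exists_lift (h : IsProjTensor E F T φ) {G : Type} [NormedAddCommGroup G]
    [NormedSpace ℂ G] [CompleteSpace G] (β : E →L[ℂ] F →L[ℂ] G) :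
    ∃ B : T →L[ℂ] G, ∀ x y, B (φ x y) = β x y := by
  let β' : E →ₗ[ℂ] F →ₗ[ℂ] G := LinearMap.mk₂ ℂ (fun x y => β x y) (by simp) (by simp) (by simp)
    (by simp)
  have hb : ∃ C, ∀ z, ‖TensorProduct.lift β' z‖ ≤ C * ‖TensorProduct.lift φ z‖ := by
    refine ⟨‖β‖ + 1, h.lift_bound β' _ (by positivity) fun x y => ?_⟩
    have := β.le_opNorm₂ x y
    change ‖β x y‖ ≤ _
    nlinarith [mul_nonneg (norm_nonneg x) (norm_nonneg y)]
  refine ⟨(TensorProduct.lift β').extendOfNorm (TensorProduct.lift φ), fun x y => ?_⟩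
  have := LinearMap.extendOfNorm_eq (f := TensorProduct.lift β') h.dense hb (x ⊗ₜ[ℂ] y)
  simpa [β'] using this

lemma isClosed_balancer {A : Type} (r : E → A → E) (l : A → F → F) :
    IsClosed (balancer φ r l : Set T) := Submodule.isClosed_topologicalClosure _

instance t2_balancer {A : Type} (r : E → A → E) (l : A → F → F) :
    T2Space (T ⧸ balancer φ r l) := by
  have := isClosed_balancer (φ := φ) r l
  infer_instance

lemma mk_balance {A : Type} (r : E → A → E) (l : A → F → F) (x : E) (a : A) (y : F) :
    (Submodule.Quotient.mk (φ (r x a) y) : T ⧸ balancer φ r l)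
      = Submodule.Quotient.mk (φ x (l a y)) := by
  rw [Submodule.Quotient.eq]
  exact Submodule.le_topologicalClosure _ (Submodule.subset_span ⟨x, a, y, rfl⟩)

lemma norm_mk_phi (h : IsProjTensor E F T φ) (N : Submodule ℂ T) (x : E) (y : F)
    (hx : ‖x‖ = 1) (hy : ‖y‖ = 1) : ‖(Submodule.Quotient.mk (φ x y) : T ⧸ N)‖ ≤ 1 := by
  refine (Submodule.Quotient.norm_mk_le _ _).trans ?_
  simpa [hx, hy] using h.norm_le x y

/-- Main criterion. -/
lemma IsProjTensor.exists_equiv (h : IsProjTensor E F T φ) {A G : Type} [NormedAddCommGroup G]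
    [NormedSpace ℂ G] [CompleteSpace G] (r : E → A → E) (l : A → F → F)
    (β : E →L[ℂ] F →L[ℂ] G) (hbal : ∀ x a y, β (r x a) y = β x (l a y))
    (s : G →L[ℂ] T ⧸ balancer φ r l)
    (hs : ∀ x y, s (β x y) = Submodule.Quotient.mk (φ x y))
    (hsurj : ∀ B : (T ⧸ balancer φ r l) →L[ℂ] G,
      (∀ x y, B (Submodule.Quotient.mk (φ x y)) = β x y) → ∀ g, B (s g) = g) :
    ∃ e : (T ⧸ balancer φ r l) ≃L[ℂ] G,
      ∀ x y, e (Submodule.Quotient.mk (φ x y)) = β x y := by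
  obtain ⟨B, hB⟩ := h.exists_lift β
  have hker : balancer φ r l ≤ B.ker := by
    refine Submodule.topologicalClosure_minimal _ ?_ B.isClosed_ker
    rw [Submodule.span_le]
    rintro _ ⟨x, a, y, rfl⟩
    simp [hB, hbal]
  let B' : (T ⧸ balancer φ r l) →L[ℂ] G := (balancer φ r l).liftQL B hker
  have hB' : ∀ x y, B' (Submodule.Quotient.mk (φ x y)) = β x y := fun x y => hB x y
  have hright := hsurj B' hB'
  have hdense : ∀ t : T, s (B' (Submodule.Quotient.mk t)) = Submodule.Quotient.mk t := by
    intro t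
    have hcl : IsClosed {t : T | (s.comp B).toLinearMap t = (balancer φ r l).mkQL t} :=
      isClosed_eq (s.comp B).continuous (balancer φ r l).mkQL.continuous
    refine h.dense.induction_on t hcl fun z => ?_
    induction z using TensorProduct.induction_on with
    | zero => simp
    | tmul x y =>
      change s (B (TensorProduct.lift φ (x ⊗ₜ[ℂ] y))) = Submodule.Quotient.mk _
      rw [TensorProduct.lift.tmul, hB, hs]
    | add z w hz hw => simp only [map_add, Submodule.Quotient.mk_add, hz, hw]
  refine ⟨ContinuousLinearEquiv.equivOfInverse B' s (fun q => ?_) hright, hB'⟩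
  obtain ⟨t, rfl⟩ := Submodule.Quotient.mk_surjective _ q
  exact hdense t

end proj

/-! ### The algebra and its modules -/

section tables
open Classical

variable (I : Type)

/-- Matrix multiplication on `ℓ¹(I × I)`. -/
def mulMI : L1 (I × I) →L[ℂ] L1 (I × I) →L[ℂ] L1 (I × I) :=
  L1.bilift (fun p q => if p.2 = q.1 then delta (p.1, q.2) else 0)
    (fun p q => by split_ifs <;> simp [norm_delta])

/-- Left action on `ℓ¹(I)`. -/
def lActI : L1 (I × I) →L[ℂ] L1 I →L[ℂ] L1 I :=
  L1.bilift (fun p q => if p.2 = q then delta p.1 else 0)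
    (fun p q => by split_ifs <;> simp [norm_delta])

/-- Right action on `ℓ¹(I)`. -/
def rActI : L1 I →L[ℂ] L1 (I × I) →L[ℂ] L1 I :=
  L1.bilift (fun p q => if p = q.1 then delta q.2 else 0)
    (fun p q => by split_ifs <;> simp [norm_delta])

/-- The duality pairing. -/
def pairI : L1 I →L[ℂ] L1 I →L[ℂ] ℂ :=
  L1.bilift (fun p q => if p = q then 1 else 0)
    (fun p q => by split_ifs <;> simp)

/-- The elementary tensor map. -/
def tensI : L1 I →L[ℂ] L1 I →L[ℂ] L1 (I × I) :=
  L1.bilift (fun p q => delta (p, q)) (fun p q => by simp [norm_delta])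

variable {I}

lemma mulMI_delta (p q : I × I) : mulMI I (delta p) (delta q) =
    if p.2 = q.1 then delta (p.1, q.2) else 0 := L1.bilift_delta _ _ _ _

lemma lActI_delta (p : I × I) (q : I) : lActI I (delta p) (delta q) =
    if p.2 = q then delta p.1 else 0 := L1.bilift_delta _ _ _ _

lemma rActI_delta (p : I) (q : I × I) : rActI I (delta p) (delta q) =
    if p = q.1 then delta q.2 else 0 := L1.bilift_delta _ _ _ _

lemma pairI_delta (p q : I) : pairI I (delta p) (delta q) =
    if p = q then 1 else 0 := L1.bilift_delta _ _ _ _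

lemma tensI_delta (p q : I) : tensI I (delta p) (delta q) = delta (p, q) :=
  L1.bilift_delta _ _ _ _

lemma tsum_row (i : I) (f : I × I → ℂ) (hf : ∀ p, p.1 ≠ i → f p = 0) :
    ∑' p, f p = ∑' k, f (i, k) := by
  refine (Function.Injective.tsum_eq (g := fun k : I => (i, k)) ?_ ?_).symm
  · intro a b h; simpa using h
  · rintro ⟨a, b⟩ h
    by_cases hi : a = i
    · subst hi; exact ⟨b, rfl⟩
    · exact absurd (hf (a, b) hi) h

lemma mulMI_apply (a b : L1 (I × I)) (i j : I) :
    mulMI I a b (i, j) = ∑' k : I, a (i, k) * b (k, j) := by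
  have h := L1.bilift_eval (fun p q : I × I => if p.2 = q.1 then delta (p.1, q.2) else 0)
    (fun p q => by split_ifs <;> simp [norm_delta]) (L1.ev (i, j)) a b
  have h2 : ∀ p : I × I, (∑' q : I × I, b q *
      L1.ev (i, j) (if p.2 = q.1 then delta (p.1, q.2) else (0 : L1 (I × I))))
      = if p.1 = i then b (p.2, j) else 0 := by
    intro p
    rw [tsum_eq_single (p.2, j)]
    · simp [L1.ev_apply, delta_apply, eq_comm]
    · rintro ⟨r, s⟩ hne
      split_ifs with h1
      · simp only [L1.ev_apply, delta_apply]
        rw [if_neg, mul_zero]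
        rintro h3
        simp_all
      · simp
  simp only [h2] at h
  rw [tsum_row i _ (fun p hp => by simp [hp])] at h
  refine Eq.trans h ?_
  simp

lemma lActI_apply (a : L1 (I × I)) (b : L1 I) (i : I) :
    lActI I a b i = ∑' k : I, a (i, k) * b k := by
  have h := L1.bilift_eval (fun (p : I × I) (q : I) => if p.2 = q then delta p.1 else 0)
    (fun p q => by split_ifs <;> simp [norm_delta]) (L1.ev i) a b
  have h2 : ∀ p : I × I, (∑' q : I, b q *
      L1.ev i (if p.2 = q then delta p.1 else (0 : L1 I)))
      = if p.1 = i then b p.2 else 0 := by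
    intro p
    rw [tsum_eq_single p.2]
    · simp [L1.ev_apply, delta_apply, eq_comm]
    · rintro r hne
      simp [hne.symm]
  simp only [h2] at h
  rw [tsum_row i _ (fun p hp => by simp [hp])] at h
  refine Eq.trans h ?_
  simp

lemma rActI_apply (a : L1 I) (b : L1 (I × I)) (j : I) :
    rActI I a b j = ∑' k : I, a k * b (k, j) := by
  have h := L1.bilift_eval (fun (p : I) (q : I × I) => if p = q.1 then delta q.2 else 0)
    (fun p q => by split_ifs <;> simp [norm_delta]) (L1.ev j) a b
  have h2 : ∀ p : I, (∑' q : I × I, b q *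
      L1.ev j (if p = q.1 then delta q.2 else (0 : L1 I)))
      = b (p, j) := by
    intro p
    rw [tsum_eq_single (p, j)]
    · simp [L1.ev_apply, delta_apply]
    · rintro ⟨r, s⟩ hne
      split_ifs with h1
      · simp only [L1.ev_apply, delta_apply]
        rw [if_neg, mul_zero]
        rintro h3
        simp_all
      · simp
  simp only [h2] at h
  exact h

/-! Associativity, checked on point masses. -/

/-- General associativity for four bilinear maps. -/
lemma L1.assoc {X Y Z U W V : Type} [NormedAddCommGroup U] [NormedSpace ℂ U]
    [NormedAddCommGroup W] [NormedSpace ℂ W] [NormedAddCommGroup V] [NormedSpace ℂ V]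
    (f : L1 X →L[ℂ] L1 Y →L[ℂ] U) (g : U →L[ℂ] L1 Z →L[ℂ] V)
    (f' : L1 Y →L[ℂ] L1 Z →L[ℂ] W) (g' : L1 X →L[ℂ] W →L[ℂ] V)
    (h : ∀ x y z, g (f (delta x) (delta y)) (delta z) = g' (delta x) (f' (delta y) (delta z)))
    (a : L1 X) (b : L1 Y) (c : L1 Z) : g (f a b) c = g' a (f' b c) := by
  refine L1.hom_eq ((g.flip c).comp (f.flip b)) (g'.flip (f' b c)) (fun x => ?_) a
  refine L1.hom_eq ((g.flip c).comp (f (delta x))) ((g' (delta x)).comp (f'.flip c)) (fun y => ?_) b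
  exact L1.hom_eq (g (f (delta x) (delta y))) ((g' (delta x)).comp (f' (delta y))) (h x y) c

lemma lActI_mul (a b : L1 (I × I)) (x : L1 I) :
    lActI I (mulMI I a b) x = lActI I a (lActI I b x) := by
  refine L1.assoc (mulMI I) (lActI I) (lActI I) (lActI I) (fun p q r => ?_) a b x
  rw [mulMI_delta, lActI_delta]
  split_ifs <;> simp_all [lActI_delta]

lemma rActI_mul (x : L1 I) (a b : L1 (I × I)) :
    rActI I (rActI I x a) b = rActI I x (mulMI I a b) := by
  refine L1.assoc (rActI I) (rActI I) (mulMI I) (rActI I) (fun p q r => ?_) x a b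
  rw [mulMI_delta, rActI_delta]
  split_ifs <;> simp_all [rActI_delta]

lemma mulMI_assoc (a b c : L1 (I × I)) :
    mulMI I (mulMI I a b) c = mulMI I a (mulMI I b c) := by
  refine L1.assoc (mulMI I) (mulMI I) (mulMI I) (mulMI I) (fun p q r => ?_) a b c
  rw [mulMI_delta, mulMI_delta]
  split_ifs <;> simp_all [mulMI_delta]

lemma pairI_bal (x : L1 I) (a : L1 (I × I)) (y : L1 I) :
    pairI I (rActI I x a) y = pairI I x (lActI I a y) := by
  refine L1.assoc (rActI I) (pairI I) (lActI I) (pairI I) (fun p q r => ?_) x a y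
  rw [rActI_delta, lActI_delta]
  split_ifs <;> simp_all [pairI_delta]

lemma tensI_left (a : L1 (I × I)) (x y : L1 I) :
    tensI I (lActI I a x) y = mulMI I a (tensI I x y) := by
  refine L1.assoc (lActI I) (tensI I) (tensI I) (mulMI I) (fun p q r => ?_) a x y
  rw [lActI_delta, tensI_delta, mulMI_delta]
  split_ifs <;> simp_all [tensI_delta]

lemma tensI_right (x y : L1 I) (a : L1 (I × I)) :
    mulMI I (tensI I x y) a = tensI I x (rActI I y a) := by
  refine L1.assoc (tensI I) (mulMI I) (rActI I) (tensI I) (fun p q r => ?_) x y a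
  rw [rActI_delta, tensI_delta, mulMI_delta]
  split_ifs <;> simp_all [tensI_delta]

end tables

/-! ### The isomorphisms -/

section isos
open Classical

lemma leftInduced_C (E : Type) [NormedAddCommGroup E] [NormedSpace ℂ E] [CompleteSpace E] :
    LeftInduced (ContinuousLinearMap.mul ℂ ℂ)
      (ContinuousLinearMap.lsmul ℂ ℂ : ℂ →L[ℂ] E →L[ℂ] E) := by
  intro T _ _ φ h
  refine h.exists_equiv _ _ (ContinuousLinearMap.lsmul ℂ ℂ) ?_
    ((Submodule.mkQL _).comp (h.toL 1)) ?_ ?_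
  · intro x a y; simp [mul_smul, smul_comm x a y]
  · intro x y
    change Submodule.Quotient.mk (φ 1 (x • y)) = _
    rw [map_smul, ← LinearMap.smul_apply, ← map_smul, smul_eq_mul, mul_one]
  · intro B hB g
    exact (hB 1 g).trans (by simp)

lemma rightInduced_C (E : Type) [NormedAddCommGroup E] [NormedSpace ℂ E] [CompleteSpace E] :
    RightInduced (ContinuousLinearMap.mul ℂ ℂ)
      (ContinuousLinearMap.lsmul ℂ ℂ : ℂ →L[ℂ] E →L[ℂ] E).flip := by
  intro T _ _ φ h
  refine h.exists_equiv _ _ (ContinuousLinearMap.lsmul ℂ ℂ : ℂ →L[ℂ] E →L[ℂ] E).flip ?_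
    ((Submodule.mkQL _).comp (h.toL.flip 1)) ?_ ?_
  · intro x a y; simp [mul_smul, smul_comm a y]
  · intro x y
    change Submodule.Quotient.mk (φ (y • x) 1) = _
    rw [map_smul, LinearMap.smul_apply, ← map_smul, smul_eq_mul, mul_one]
  · intro B hB g
    exact (hB g 1).trans (by simp)

variable {I : Type}

lemma rightInduced_M [Nonempty I] : RightInduced (mulMI I) (rActI I) := by
  intro T _ _ φ h
  have := h.complete
  obtain ⟨o⟩ := ‹Nonempty I›
  let s : L1 I →L[ℂ] T ⧸ balancer φ (fun x a => rActI I x a) (fun a b => mulMI I a b) :=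
    L1.lift (fun k => Submodule.Quotient.mk (φ (delta o) (delta (o, k))))
      (fun k => norm_mk_phi h _ _ _ (norm_delta _) (norm_delta _))
  have hsd : ∀ k, s (delta k) = Submodule.Quotient.mk (φ (delta o) (delta (o, k))) :=
    fun k => L1.lift_delta _ _ k
  refine h.exists_equiv _ _ (rActI I) rActI_mul s ?_ ?_
  · refine L1.hom_eq₂ ((ContinuousLinearMap.compL ℂ _ _ _ s).comp (rActI I))
      ((ContinuousLinearMap.compL ℂ _ _ _ (Submodule.mkQL _)).comp h.toL) (fun i p => ?_)
    change s (rActI I (delta i) (delta p)) = Submodule.Quotient.mk (φ (delta i) (delta p))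
    have h1 := mk_balance (φ := φ) (fun x a => rActI I x a) (fun a b => mulMI I a b)
      (delta o) (delta (o, i)) (delta p)
    simp only [rActI_delta, mulMI_delta, if_true] at h1
    rw [h1, rActI_delta]
    split_ifs with hi
    · rw [hsd]
    · simp
  · intro B hB
    refine L1.hom_eq (B.comp s) (ContinuousLinearMap.id ℂ _) (fun k => ?_)
    change B (s (delta k)) = delta k
    rw [hsd, hB, rActI_delta, if_pos rfl]

lemma leftInduced_M [Nonempty I] : LeftInduced (mulMI I) (lActI I) := by
  intro T _ _ φ h
  have := h.complete
  obtain ⟨o⟩ := ‹Nonempty I›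
  let s : L1 I →L[ℂ] T ⧸ balancer φ (fun a b => mulMI I a b) (fun a x => lActI I a x) :=
    L1.lift (fun k => Submodule.Quotient.mk (φ (delta (k, o)) (delta o)))
      (fun k => norm_mk_phi h _ _ _ (norm_delta _) (norm_delta _))
  have hsd : ∀ k, s (delta k) = Submodule.Quotient.mk (φ (delta (k, o)) (delta o)) :=
    fun k => L1.lift_delta _ _ k
  refine h.exists_equiv _ _ (lActI I) lActI_mul s ?_ ?_
  · refine L1.hom_eq₂ ((ContinuousLinearMap.compL ℂ _ _ _ s).comp (lActI I))
      ((ContinuousLinearMap.compL ℂ _ _ _ (Submodule.mkQL _)).comp h.toL) (fun p i => ?_)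
    change s (lActI I (delta p) (delta i)) = Submodule.Quotient.mk (φ (delta p) (delta i))
    have h1 := mk_balance (φ := φ) (fun a b => mulMI I a b) (fun a x => lActI I a x)
      (delta p) (delta (i, o)) (delta o)
    simp only [lActI_delta, mulMI_delta, if_true] at h1
    rw [← h1, lActI_delta]
    split_ifs with hi
    · rw [hsd]
    · simp
  · intro B hB
    refine L1.hom_eq (B.comp s) (ContinuousLinearMap.id ℂ _) (fun k => ?_)
    change B (s (delta k)) = delta k
    rw [hsd, hB, lActI_delta, if_pos rfl]

lemma isoB_M [Nonempty I] (T : Type) [SeminormedAddCommGroup T] [NormedSpace ℂ T]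
    (φ : L1 I →ₗ[ℂ] L1 I →ₗ[ℂ] T) (h : IsProjTensor (L1 I) (L1 I) T φ) :
    ∃ e : (T ⧸ balancer φ (fun x a => rActI I x a) (fun a y => lActI I a y)) ≃L[ℂ] ℂ,
      ∀ x y, e (Submodule.Quotient.mk (φ x y)) = pairI I x y := by
  obtain ⟨o⟩ := ‹Nonempty I›
  let s : ℂ →L[ℂ] T ⧸ balancer φ (fun x a => rActI I x a) (fun a y => lActI I a y) :=
    (ContinuousLinearMap.lsmul ℂ ℂ).flip (Submodule.Quotient.mk (φ (delta o) (delta o)))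
  have hsd : ∀ c, s c = c • Submodule.Quotient.mk (φ (delta o) (delta o)) := fun c => rfl
  refine h.exists_equiv _ _ (pairI I) pairI_bal s ?_ ?_
  · refine L1.hom_eq₂ ((ContinuousLinearMap.compL ℂ _ _ _ s).comp (pairI I))
      ((ContinuousLinearMap.compL ℂ _ _ _ (Submodule.mkQL _)).comp h.toL) (fun i p => ?_)
    change s (pairI I (delta i) (delta p)) = Submodule.Quotient.mk (φ (delta i) (delta p))
    have h1 := mk_balance (φ := φ) (fun x a => rActI I x a) (fun a y => lActI I a y)
      (delta o) (delta (o, i)) (delta p)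
    simp only [rActI_delta, lActI_delta, if_true] at h1
    rw [h1, pairI_delta, hsd]
    split_ifs with hi
    · simp
    · simp
  · intro B hB c
    rw [hsd, map_smul, hB, pairI_delta]
    simp

lemma isoA_M (T : Type) [SeminormedAddCommGroup T] [NormedSpace ℂ T]
    (φ : L1 I →ₗ[ℂ] L1 I →ₗ[ℂ] T) (h : IsProjTensor (L1 I) (L1 I) T φ) :
    ∃ e : (T ⧸ balancer φ (fun (x : L1 I) (c : ℂ) => c • x)
            (fun (c : ℂ) (y : L1 I) => c • y)) ≃L[ℂ] L1 (I × I),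
      ∀ x y, e (Submodule.Quotient.mk (φ x y)) = tensI I x y := by
  have := h.complete
  let s : L1 (I × I) →L[ℂ] T ⧸ balancer φ (fun (x : L1 I) (c : ℂ) => c • x)
            (fun (c : ℂ) (y : L1 I) => c • y) :=
    L1.lift (fun k => Submodule.Quotient.mk (φ (delta k.1) (delta k.2)))
      (fun k => norm_mk_phi h _ _ _ (norm_delta _) (norm_delta _))
  have hsd : ∀ k, s (delta k) = Submodule.Quotient.mk (φ (delta k.1) (delta k.2)) :=
    fun k => L1.lift_delta _ _ k
  refine h.exists_equiv _ _ (tensI I) (by intro x a y; simp) s ?_ ?_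
  · refine L1.hom_eq₂ ((ContinuousLinearMap.compL ℂ _ _ _ s).comp (tensI I))
      ((ContinuousLinearMap.compL ℂ _ _ _ (Submodule.mkQL _)).comp h.toL) (fun i p => ?_)
    change s (tensI I (delta i) (delta p)) = Submodule.Quotient.mk (φ (delta i) (delta p))
    rw [tensI_delta, hsd]
  · intro B hB
    refine L1.hom_eq (B.comp s) (ContinuousLinearMap.id ℂ _) (fun k => ?_)
    change B (s (delta k)) = delta k
    rw [hsd, hB, tensI_delta]

/-- The Morita context. -/
def moritaWitness_M (I : Type) [Nonempty I] :
    MoritaWitness (L1 (I × I)) ℂ (mulMI I) (ContinuousLinearMap.mul ℂ ℂ) where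
  P := L1 I
  Q := L1 I
  lP := ContinuousLinearMap.lsmul ℂ ℂ
  rP := rActI I
  lQ := lActI I
  rQ := (ContinuousLinearMap.lsmul ℂ ℂ : ℂ →L[ℂ] L1 I →L[ℂ] L1 I).flip
  lawP := ⟨fun a b x => by simp [mul_smul, smul_comm a b x], rActI_mul, fun a x b => by simp⟩
  lawQ := ⟨lActI_mul, fun x a b => by simp [mul_smul, smul_comm a b], fun a x b => by simp⟩
  indPl := leftInduced_C _
  indPr := rightInduced_M
  indQl := leftInduced_M
  indQr := rightInduced_C _
  isoB := fun T _ _ φ h => by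
    obtain ⟨e, he⟩ := isoB_M T φ h
    refine ⟨e, fun b p q => ?_, fun b p q => ?_⟩
    · rw [he, he]; simp
    · rw [he, he]; simp [mul_comm]
  isoA := fun T _ _ φ h => by
    obtain ⟨e, he⟩ := isoA_M T φ h
    refine ⟨e, fun a q p => ?_, fun a q p => ?_⟩
    · exact (he _ _).trans ((tensI_left a q p).trans (congrArg _ (he q p).symm))
    · exact (he _ _).trans ((tensI_right q p a).symm.trans
        (congrArg (fun z => mulMI I z a) (he q p).symm))

end isos

/-- `M_I` is Morita equivalent to `ℂ`: with `P = ℓ¹(I)` as a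
left-`ℂ` right-`M_I` Banach bimodule and `Q = ℓ¹(I)` as a left-`M_I` right-`ℂ`
Banach bimodule, `P` and `Q` are two-sided induced, `P ⊗̂_{M_I} Q ≅ ℂ`, and
`Q ⊗̂_ℂ P ≅ M_I` as `M_I`-bimodules; hence `M_I ≈ ℂ`. -/
theorem brandt_morita_stmt6 (I : Type) [Nonempty I] :
    ∃ (mulM : L1 (I × I) →L[ℂ] L1 (I × I) →L[ℂ] L1 (I × I))
      (lAct : L1 (I × I) →L[ℂ] L1 I →L[ℂ] L1 I)
      (rAct : L1 I →L[ℂ] L1 (I × I) →L[ℂ] L1 I),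
      (∀ (a b : L1 (I × I)) (i j : I), mulM a b (i, j) = ∑' k : I, a (i, k) * b (k, j)) ∧
      (∀ (a : L1 (I × I)) (x : L1 I) (i : I), lAct a x i = ∑' k : I, a (i, k) * x k) ∧
      (∀ (x : L1 I) (a : L1 (I × I)) (i : I), rAct x a i = ∑' k : I, x k * a (k, i)) ∧
      -- `P = ℓ¹(I)` is two-sided induced: left over `ℂ`, right over `M_I`
      LeftInduced (ContinuousLinearMap.mul ℂ ℂ)
        (ContinuousLinearMap.lsmul ℂ ℂ : ℂ →L[ℂ] L1 I →L[ℂ] L1 I) ∧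
      RightInduced mulM rAct ∧
      -- `Q = ℓ¹(I)` is two-sided induced: left over `M_I`, right over `ℂ`
      LeftInduced mulM lAct ∧
      RightInduced (ContinuousLinearMap.mul ℂ ℂ)
        ((ContinuousLinearMap.lsmul ℂ ℂ : ℂ →L[ℂ] L1 I →L[ℂ] L1 I).flip) ∧
      -- `P ⊗̂_{M_I} Q` is topologically isomorphic to `ℂ`
      (∀ (T : Type) [NormedAddCommGroup T] [NormedSpace ℂ T]
        (φ : L1 I →ₗ[ℂ] L1 I →ₗ[ℂ] T), IsProjTensor (L1 I) (L1 I) T φ →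
        ∃ _e : (T ⧸ balancer φ (fun x a => rAct x a) (fun a y => lAct a y)) ≃L[ℂ] ℂ,
          True) ∧
      -- `Q ⊗̂_ℂ P` is topologically isomorphic to `M_I` as an `M_I`-bimodule
      (∀ (T : Type) [NormedAddCommGroup T] [NormedSpace ℂ T]
        (φ : L1 I →ₗ[ℂ] L1 I →ₗ[ℂ] T), IsProjTensor (L1 I) (L1 I) T φ →
        ∃ e : (T ⧸ balancer φ (fun (x : L1 I) (c : ℂ) => c • x)
            (fun (c : ℂ) (y : L1 I) => c • y)) ≃L[ℂ] L1 (I × I),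
          (∀ (a : L1 (I × I)) (q p : L1 I),
            e (Submodule.Quotient.mk (φ (lAct a q) p))
              = mulM a (e (Submodule.Quotient.mk (φ q p)))) ∧
          (∀ (a : L1 (I × I)) (q p : L1 I),
            e (Submodule.Quotient.mk (φ q (rAct p a)))
              = mulM (e (Submodule.Quotient.mk (φ q p))) a)) ∧
      -- in particular, `M_I` and `ℂ` are Morita equivalent
      MoritaEquivalent mulM (ContinuousLinearMap.mul ℂ ℂ) := by
  refine ⟨mulMI I, lActI I, rActI I, mulMI_apply, lActI_apply, rActI_apply, leftInduced_C _,
    rightInduced_M, leftInduced_M, rightInduced_C _, ?_, ?_, ⟨moritaWitness_M I⟩⟩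
  · intro T _ _ φ h
    obtain ⟨e, -⟩ := isoB_M T φ h
    exact ⟨e, trivial⟩
  · intro T _ _ φ h
    obtain ⟨e, he⟩ := isoA_M T φ h
    refine ⟨e, fun a q p => ?_, fun a q p => ?_⟩
    · rw [he, he, tensI_left]
    · rw [he, he, tensI_right]
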